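/- Let β ∈ (0,2], μ ∈ (1/2,1] and s ≥ −1. Define η_β(k,ξ) = ∫₀^∞ t^{2−2μ} ω_β(k,ξ−tk)^{2(s+1)} e_β(t,k,ξ−tk)² dt. Then there exists a constant c₂ = c₂(β,μ) > 0 such that c₂ · ω_β(k,ξ)^{2(s+1/2−(1−μ))} ≤ η_β(k,ξ) for all k, ξ ∈ ℝⁿ. -/

import Mathlib

open MeasureTheory Set Filter
open scoped ENNReal

noncomputable section

/-- `ℝⁿ` with the Euclidean norm. -/
abbrev En (n : ℕ) : Type := EuclideanSpace ℝ (Fin n)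

/-- `e_β(t,k,ξ) = exp(−∫₀ᵗ ‖ξ + σ k‖^β dσ)`. -/
def eB (n : ℕ) (β t : ℝ) (k ξ : En n) : ℝ :=
  Real.exp (-(∫ σ in (0:ℝ)..t, ‖ξ + σ • k‖ ^ β))

/-- `ω_β(k,ξ) = 1 + ‖k‖^{β/(β+1)} + ‖ξ‖^β`. -/
def omegaB (n : ℕ) (β : ℝ) (k ξ : En n) : ℝ := 1 + ‖k‖ ^ (β / (β + 1)) + ‖ξ‖ ^ β

lemma exp_le_eB_sq (n : ℕ) {β t : ℝ} (hβ : 0 < β) (ht : 0 ≤ t) (k ξ : En n) :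
    Real.exp (-(2 * (t * (‖ξ‖ + t * ‖k‖) ^ β))) ≤ eB n β t k (ξ - t • k) ^ 2 := by
  have hint : (∫ σ in (0:ℝ)..t, ‖ξ - t • k + σ • k‖ ^ β) ≤ (‖ξ‖ + t * ‖k‖) ^ β * |t - 0| := by
    refine (le_abs_self _).trans ?_
    rw [← Real.norm_eq_abs]
    refine intervalIntegral.norm_integral_le_of_norm_le_const fun σ hσ => ?_
    rw [uIoc_of_le ht] at hσ
    rw [Real.norm_of_nonneg (by positivity)]
    refine Real.rpow_le_rpow (norm_nonneg _) ?_ hβ.le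
    have h : ξ - t • k + σ • k = ξ - (t - σ) • k := by module
    rw [h]
    refine (norm_sub_le _ _).trans ?_
    rw [norm_smul, Real.norm_of_nonneg (by linarith [hσ.2])]
    have := mul_nonneg hσ.1.le (norm_nonneg k)
    linarith
  rw [sub_zero, abs_of_nonneg ht] at hint
  rw [eB, ← Real.exp_nat_mul]
  refine Real.exp_le_exp.2 ?_
  push_cast
  linarith

lemma le_omegaB_sub (n : ℕ) {β r : ℝ} (hβ : 0 < β) (hr : 0 ≤ r) {k ζ : En n} (h : r ≤ ‖ζ‖) :
    1 + ‖k‖ ^ (β / (β + 1)) + r ^ β ≤ omegaB n β k ζ := by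
  have := Real.rpow_le_rpow hr h hβ.le
  unfold omegaB
  linarith

lemma one_le_omegaB (n : ℕ) (β : ℝ) (k ξ : En n) : 1 ≤ omegaB n β k ξ := by
  have h₁ : 0 ≤ ‖k‖ ^ (β / (β + 1)) := by positivity
  have h₂ : 0 ≤ ‖ξ‖ ^ β := by positivity
  unfold omegaB
  linarith

lemma rpow_norm_le_omegaB (n : ℕ) (β : ℝ) (k ξ : En n) : ‖ξ‖ ^ β ≤ omegaB n β k ξ := by
  have h₁ : 0 ≤ ‖k‖ ^ (β / (β + 1)) := by positivity
  unfold omegaB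
  linarith

lemma div_omegaB_rpow_le (n : ℕ) {β : ℝ} (hβ : 0 < β) (k ξ : En n) :
    (‖k‖ / omegaB n β k ξ) ^ β ≤ omegaB n β k ξ := by
  have hW := one_le_omegaB n β k ξ
  have hk : ‖k‖ ^ (β / (β + 1)) ≤ omegaB n β k ξ := by
    have h₂ : 0 ≤ ‖ξ‖ ^ β := by positivity
    unfold omegaB
    linarith
  have h := Real.rpow_le_rpow (by positivity) hk (by positivity : 0 ≤ β + 1)
  rw [← Real.rpow_mul (norm_nonneg _), div_mul_cancel₀ _ (by positivity),
    Real.rpow_add (by linarith), Real.rpow_one] at h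
  rw [Real.div_rpow (norm_nonneg _) (by linarith), div_le_iff₀ (by positivity)]
  linarith

lemma const_mul_rpow_le {β c x : ℝ} (hβ : β ≤ 2) (hc : 1 ≤ c) (hx : 0 ≤ x) :
    (c * x) ^ β ≤ c ^ 2 * x ^ β := by
  rw [Real.mul_rpow (by linarith) hx, ← Real.rpow_two]
  gcongr

/-- A lower bound of the integrand on a dyadic interval `[p, 2p]` with `p` at least of order
`1 / ω` bounds the integral from below. -/
lemma ofReal_le_lintegral_of_dyadic {p a S W κ : ℝ} (ha : 0 ≤ a) (ha' : a ≤ 1) (hp : 0 < p)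
    (hW : 0 < W) (hpW : 1 / 8 ≤ p * W) (hκ : 0 ≤ κ) {f g : ℝ → ℝ}
    (h : ∀ t, p ≤ t → t ≤ 2 * p → κ * W ^ S ≤ f t * g t) :
    ENNReal.ofReal (κ / 64 * W ^ (S - 1 - a)) ≤
      ∫⁻ t in Ioi (0:ℝ), ENNReal.ofReal (t ^ a * f t * g t) := by
  have hpow : 1 / 64 ≤ (p * W) ^ (1 + a) := by
    calc (1 / 64 : ℝ) = (1 / 8) ^ (2 : ℝ) := by norm_num
      _ ≤ (1 / 8) ^ (1 + a) :=
        Real.rpow_le_rpow_of_exponent_ge (by norm_num) (by norm_num) (by linarith)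
      _ ≤ _ := Real.rpow_le_rpow (by norm_num) hpW (by linarith)
  have hsplit : W ^ S = W ^ (S - 1 - a) * W ^ (1 + a) := by
    rw [← Real.rpow_add hW]; congr 1; ring
  have hmain : κ / 64 * W ^ (S - 1 - a) ≤ (p ^ a * (κ * W ^ S)) * p := by
    have : (p ^ a * (κ * W ^ S)) * p = κ * W ^ (S - 1 - a) * (p * W) ^ (1 + a) := by
      rw [hsplit, Real.mul_rpow hp.le hW.le, Real.rpow_add hp, Real.rpow_one]; ring
    rw [this]
    have := mul_le_mul_of_nonneg_left hpow (by positivity : 0 ≤ κ * W ^ (S - 1 - a))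
    linarith
  calc ENNReal.ofReal (κ / 64 * W ^ (S - 1 - a))
      ≤ ENNReal.ofReal ((p ^ a * (κ * W ^ S)) * p) := ENNReal.ofReal_le_ofReal hmain
    _ = ∫⁻ _ in Icc p (2 * p), ENNReal.ofReal (p ^ a * (κ * W ^ S)) := by
        rw [setLIntegral_const, Real.volume_Icc, ← ENNReal.ofReal_mul (by positivity)]
        congr 1; ring
    _ ≤ ∫⁻ t in Icc p (2 * p), ENNReal.ofReal (t ^ a * f t * g t) := by
        refine setLIntegral_mono' measurableSet_Icc fun t ht => ENNReal.ofReal_le_ofReal ?_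
        rw [mul_assoc]
        have h₁ := h t ht.1 ht.2
        exact mul_le_mul (Real.rpow_le_rpow hp.le ht.1 ha) h₁ (by positivity)
          (Real.rpow_nonneg (hp.le.trans ht.1) _)
    _ ≤ _ := lintegral_mono_set fun t ht => hp.trans_le ht.1

lemma exp_mul_rpow_le {S W w x : ℝ} (hS : 0 ≤ S) (hW : 0 < W) (h : Real.exp x * W ≤ w) :
    Real.exp (S * x) * W ^ S ≤ w ^ S := by
  have := Real.rpow_le_rpow (by positivity) h hS
  rwa [Real.mul_rpow (Real.exp_pos x).le hW.le, ← Real.exp_mul, mul_comm x] at this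

lemma exp_neg_two_mul_le {y : ℝ} (hy : 0 ≤ y) (hy' : y ≤ 1 / 2) :
    Real.exp (-(2 * y)) ≤ 1 - y := by
  have h : 1 + 2 * y ≤ Real.exp (2 * y) := by linarith [Real.add_one_le_exp (2 * y)]
  rw [Real.exp_neg]
  refine inv_le_of_inv_le₀ (by linarith) (le_trans ?_ h)
  rw [inv_le_iff_one_le_mul₀ (by linarith)]
  nlinarith

lemma exp_div_four_le {y : ℝ} (hy : 0 ≤ y) (hy' : y ≤ 3) : Real.exp (y / 4) ≤ 1 + y := by
  have h : 1 - y / 4 ≤ Real.exp (-(y / 4)) := by linarith [Real.add_one_le_exp (-(y / 4))]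
  rw [Real.exp_neg] at h
  refine (le_inv_of_le_inv₀ (by linarith) h).trans ?_
  rw [inv_le_iff_one_le_mul₀ (by linarith)]
  nlinarith

theorem stmt4 (n : ℕ) (hn : 1 ≤ n) (β μ : ℝ) (hβ : β ∈ Ioc (0:ℝ) 2)
    (hμ : μ ∈ Ioc (1/2 : ℝ) 1) :
    ∃ c₂ : ℝ, 0 < c₂ ∧ ∀ s : ℝ, (-1:ℝ) ≤ s → ∀ k ξ : En n,
      ENNReal.ofReal (c₂ * omegaB n β k ξ ^ (2 * (s + 1/2 - (1 - μ))))
        ≤ ∫⁻ t in Ioi (0:ℝ), ENNReal.ofReal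
            (t ^ (2 - 2*μ) * omegaB n β k (ξ - t • k) ^ (2 * (s + 1)) * eB n β t k (ξ - t • k) ^ 2) := by
  obtain ⟨hβ0, hβ2⟩ := hβ
  obtain ⟨hμ1, hμ2⟩ := hμ
  have hq : 0 < (2:ℝ) ^ β - 1 := by linarith [Real.one_lt_rpow (by norm_num : (1:ℝ) < 2) hβ0]
  have hq3 : (2:ℝ) ^ β - 1 ≤ 3 := by
    have := Real.rpow_le_rpow_of_exponent_le (by norm_num : (1:ℝ) ≤ 2) hβ2
    norm_num at this
    linarith
  obtain ⟨M, hM⟩ : ∃ M : ℝ, M = 2352 / ((2:ℝ) ^ β - 1) := ⟨_, rfl⟩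
  have hM0 : 0 < M := by rw [hM]; positivity
  refine ⟨Real.exp (-(590 + M)) / 64, by positivity, fun s hs k ξ => ?_⟩
  have hexp : 2 * (s + 1/2 - (1 - μ)) = 2 * (s + 1) - 1 - (2 - 2 * μ) := by ring
  rw [hexp]
  have hS : 0 ≤ 2 * (s + 1) := by linarith
  generalize 2 * (s + 1) = S at hS ⊢
  have hW1 := one_le_omegaB n β k ξ
  have hLW := rpow_norm_le_omegaB n β k ξ
  have hKW := div_omegaB_rpow_le n hβ0 k ξ
  have hWdef : omegaB n β k ξ = 1 + ‖k‖ ^ (β / (β + 1)) + ‖ξ‖ ^ β := rfl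
  have hω : ∀ {r t : ℝ}, 0 ≤ r → r ≤ ‖ξ - t • k‖ →
      omegaB n β k ξ + r ^ β - ‖ξ‖ ^ β ≤ omegaB n β k (ξ - t • k) := fun hr h => by
    linarith [le_omegaB_sub n hβ0 hr h (k := k)]
  have hL := norm_nonneg ξ
  have hK := norm_nonneg k
  have hfar : ∀ {t : ℝ}, 0 ≤ t → t * ‖k‖ - ‖ξ‖ ≤ ‖ξ - t • k‖ := fun {t} ht => by
    have := norm_sub_norm_le (t • k) ξ
    rwa [norm_smul, Real.norm_of_nonneg ht, norm_sub_rev] at this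
  have hnear : ∀ {t : ℝ}, 0 ≤ t → ‖ξ‖ - t * ‖k‖ ≤ ‖ξ - t • k‖ := fun {t} ht => by
    have := norm_sub_norm_le ξ (t • k)
    rwa [norm_smul, Real.norm_of_nonneg ht] at this
  have he : ∀ {t : ℝ}, 0 ≤ t → _ := fun {t} ht => exp_le_eB_sq n (t := t) hβ0 ht k ξ
  generalize omegaB n β k ξ = W at *
  generalize ‖ξ‖ = L at *
  generalize ‖k‖ = K at *
  have hW : 0 < W := by linarith
  have hLβ : 0 ≤ L ^ β := Real.rpow_nonneg hL _
  suffices ∃ p : ℝ, 0 < p ∧ 1 / 8 ≤ p * W ∧ ∀ t, p ≤ t → t ≤ 2 * p →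
      ∃ x y : ℝ, Real.exp x * W ≤ omegaB n β k (ξ - t • k) ∧ t * (L + t * K) ^ β ≤ y ∧
        -(590 + M) ≤ S * x - 2 * y by
    obtain ⟨p, hp, hpW, h⟩ := this
    refine ofReal_le_lintegral_of_dyadic (by linarith) (by linarith) hp hW hpW
      (Real.exp_pos _).le fun t ht ht' => ?_
    obtain ⟨x, y, hx, hy, hxy⟩ := h t ht ht'
    have ht0 : 0 ≤ t := hp.le.trans ht
    calc Real.exp (-(590 + M)) * W ^ S ≤ Real.exp (S * x - 2 * y) * W ^ S := by gcongr
      _ = (Real.exp (S * x) * W ^ S) * Real.exp (-(2 * y)) := by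
        rw [sub_eq_add_neg, Real.exp_add]; ring
      _ ≤ _ := mul_le_mul (exp_mul_rpow_le hS hW hx)
        ((Real.exp_le_exp.2 (by linarith)).trans (he ht0)) (Real.exp_pos _).le
        (Real.rpow_nonneg (by linarith [one_le_omegaB n β k (ξ - t • k)]) _)
  rcases le_or_gt (L * W) K with hA | hB
  · have hLK : L ≤ K / W := by rwa [le_div_iff₀ hW]
    refine ⟨3 / W, by positivity, by rw [div_mul_cancel₀ _ hW.ne']; norm_num,
      fun t ht ht' => ⟨0, 294, ?_, ?_, by linarith⟩⟩
    · have ht0 : 0 ≤ t := le_trans (by positivity) ht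
      have htK : 3 / W * K ≤ t * K := by gcongr
      have : 3 / W * K = 3 * (K / W) := by ring
      have := hω hL (by linarith [hfar ht0])
      rw [Real.exp_zero]
      linarith
    · have ht0 : 0 ≤ t := le_trans (by positivity) ht
      have htK : t * K ≤ 2 * (3 / W) * K := by gcongr
      have : 2 * (3 / W) * K = 6 * (K / W) := by ring
      calc t * (L + t * K) ^ β ≤ 2 * (3 / W) * (7 * (K / W)) ^ β := by
            gcongr
            linarith
        _ ≤ 2 * (3 / W) * (7 ^ 2 * W) := by
            gcongr
            exact (const_mul_rpow_le hβ2 (by norm_num) (by positivity)).trans (by gcongr)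
        _ = 294 := by field_simp; norm_num
  have hL0 : 0 < L := by
    by_contra! h
    have : L = 0 := le_antisymm h hL
    rw [this, zero_mul] at hB
    linarith
  rcases le_or_gt (S * K) (M * L * W) with hC | hC
  · refine ⟨1 / (8 * W), by positivity, by field_simp; rfl, fun t ht ht' => ?_⟩
    have ht0 : 0 ≤ t := le_trans (by positivity) ht
    have htW : t * W ≤ 1 / 4 := by
      calc t * W ≤ 2 * (1 / (8 * W)) * W := by gcongr
        _ = 1 / 4 := by field_simp; norm_num
    have hx0 : 0 ≤ t * K / L := by positivity
    have hx : t * K / L ≤ 1 / 4 := by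
      rw [div_le_iff₀ hL0]
      nlinarith
    have hxL : t * K / L * L = t * K := div_mul_cancel₀ _ hL0.ne'
    have hSx : S * (t * K / L) ≤ M / 4 := by
      rw [← mul_div_assoc, div_le_iff₀ hL0]
      calc S * (t * K) = t * (S * K) := by ring
        _ ≤ t * (M * L * W) := by gcongr
        _ = (t * W) * (M * L) := by ring
        _ ≤ 1 / 4 * (M * L) := by gcongr
        _ = M / 4 * L := by ring
    generalize t * K / L = x at *
    refine ⟨-(2 * (2 * x)), 1, ?_, ?_, by linarith⟩
    · have hr : (1 - x) * L ≤ ‖ξ - t • k‖ := by linarith [hnear ht0]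
      have h1 := hω (mul_nonneg (by linarith) hL) hr
      have h2 : (1 - 2 * x) * L ^ β ≤ ((1 - x) * L) ^ β := by
        rw [Real.mul_rpow (by linarith) hL]
        refine mul_le_mul_of_nonneg_right ?_ hLβ
        calc 1 - 2 * x ≤ (1 - x) ^ (2:ℝ) := by rw [Real.rpow_two]; nlinarith
          _ ≤ (1 - x) ^ β :=
            Real.rpow_le_rpow_of_exponent_ge (by linarith) (by linarith) hβ2
      have h3 := exp_neg_two_mul_le (y := 2 * x) (by linarith) (by linarith)
      calc Real.exp (-(2 * (2 * x))) * W ≤ (1 - 2 * x) * W := by gcongr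
        _ ≤ _ := by nlinarith
    · calc t * (L + t * K) ^ β ≤ t * (2 * L) ^ β := by
            gcongr
            nlinarith
        _ ≤ t * (2 ^ 2 * W) := by
            gcongr
            exact (const_mul_rpow_le hβ2 (by norm_num) hL).trans (by gcongr)
        _ ≤ 1 := by linarith
  · have hK0 : 0 < K := by
      by_contra! h
      have : K = 0 := le_antisymm h hK
      rw [this, mul_zero] at hC
      have : 0 < M * L * W := by positivity
      linarith
    have hpW : 1 ≤ L / K * W := by
      rw [div_mul_eq_mul_div, le_div_iff₀ hK0]
      linarith
    refine ⟨3 * (L / K), by positivity, by linarith, fun t ht ht' => ?_⟩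
    have ht0 : 0 ≤ t := le_trans (by positivity) ht
    have hKL : L / K * K = L := div_mul_cancel₀ _ hK0.ne'
    have htK : 3 * L ≤ t * K := by nlinarith
    have htK' : t * K ≤ 6 * L := by nlinarith
    refine ⟨((2:ℝ) ^ β - 1) * (L ^ β / W) / 4, 294 * (L / K * L ^ β), ?_, ?_, ?_⟩
    · have hy : L ^ β / W ≤ 1 := (div_le_one hW).2 hLW
      have hy0 : 0 ≤ L ^ β / W := by positivity
      have h1 := exp_div_four_le (y := ((2:ℝ) ^ β - 1) * (L ^ β / W)) (by positivity)
        (by nlinarith)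
      have h2 := hω (r := 2 * L) (t := t) (by positivity) (by linarith [hfar ht0])
      rw [Real.mul_rpow (by norm_num) hL] at h2
      calc _ ≤ (1 + ((2:ℝ) ^ β - 1) * (L ^ β / W)) * W := by gcongr
        _ = W + 2 ^ β * L ^ β - L ^ β := by field_simp; ring
        _ ≤ _ := h2
    · calc t * (L + t * K) ^ β ≤ 2 * (3 * (L / K)) * (7 * L) ^ β := by
            gcongr
            linarith
        _ ≤ 2 * (3 * (L / K)) * (7 ^ 2 * L ^ β) := by
            gcongr
            exact const_mul_rpow_le hβ2 (by norm_num) hL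
        _ = _ := by ring
    · have hSM : M * (L / K) ≤ S / W := by
        rw [le_div_iff₀ hW, ← mul_div_assoc, div_mul_eq_mul_div, div_le_iff₀ hK0]
        exact hC.le
      have hqM : ((2:ℝ) ^ β - 1) * M = 2352 := by
        rw [hM]
        field_simp
      have h1 : S * (((2:ℝ) ^ β - 1) * (L ^ β / W) / 4) =
          ((2:ℝ) ^ β - 1) * L ^ β / 4 * (S / W) := by ring
      have h2 : ((2:ℝ) ^ β - 1) * L ^ β / 4 * (M * (L / K)) ≤
          ((2:ℝ) ^ β - 1) * L ^ β / 4 * (S / W) := by gcongr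
      have h3 : ((2:ℝ) ^ β - 1) * L ^ β / 4 * (M * (L / K)) = 588 * (L / K * L ^ β) := by
        linear_combination (L ^ β / 4 * (L / K)) * hqM
      linarith
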